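/- arXiv:1107.1720 — 4 statements merged into one kernel-verified Lean document; each statement's English description precedes it below -/
import Mathlib

section
/- Let Z be a polygonal curve in ℝ^d with vertices z_0, …, z_n, let 1 ≤ i < j ≤ n, let e_i be the edge z_{i−1}z_i and e_j the edge z_{j−1}z_j, and let u, v ∈ ℝ^d. Let Ẑ denote the subcurve of Z from z_i to z_{j−1}, define α = inf over 0 ≤ s ≤ t ≤ 1 of d_F(Ẑ, segment from u + s(v−u) to u + t(v−u)), and define the canonical price π* = max(dist(u, e_i), α, dist(v, e_j)). Let δ ≥ 0, and let p ∈ e_i and q ∈ e_j be points with ‖p − u‖ ≤ δ and ‖q − v‖ ≤ δ (a feasible tunnel of the family determined by e_i, e_j, u, v). Then: (i) if δ ≤ π*, the Fréchet distance between the subcurve of Z from p to q and the segment uv is exactly π*; (ii) if δ > π*, this Fréchet distance is at most δ. -/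
open Set

noncomputable section

namespace Jaywalk

variable {d : ℕ}

/-- An orientation-preserving reparameterization of `[0,1]`: a continuous, strictly
increasing bijection of `[0,1]` onto itself with `f 0 = 0` and `f 1 = 1`. -/
structure IsReparam (f : ℝ → ℝ) : Prop where
  contOn : ContinuousOn f (Icc 0 1)
  strictMonoOn : StrictMonoOn f (Icc 0 1)
  mapsTo : MapsTo f (Icc 0 1) (Icc 0 1)
  surjOn : SurjOn f (Icc 0 1) (Icc 0 1)
  map_zero : f 0 = 0
  map_one : f 1 = 1

/-- The width of a reparameterization `f` with respect to curves `X Y : [0,1] → ℝ^d`. -/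
def frechetWidth (X Y : ℝ → EuclideanSpace ℝ (Fin d)) (f : ℝ → ℝ) : ℝ :=
  ⨆ t : Icc (0:ℝ) 1, ‖X (f ↑t) - Y ↑t‖

/-- The Fréchet distance between two curves `X Y : [0,1] → ℝ^d`. -/
def frechetDist (X Y : ℝ → EuclideanSpace ℝ (Fin d)) : ℝ :=
  sInf {w | ∃ f, IsReparam f ∧ w = frechetWidth X Y f}

/-- The segment from `p` to `q`, as a curve `t ↦ (1-t)·p + t·q`. -/
def seg (p q : EuclideanSpace ℝ (Fin d)) : ℝ → EuclideanSpace ℝ (Fin d) :=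
  fun t => (1 - t) • p + t • q

/-- The subcurve `Z[s,t]`, affinely reparameterized over `[0,1]`. -/
def subcurve (Z : ℝ → EuclideanSpace ℝ (Fin d)) (s t : ℝ) : ℝ → EuclideanSpace ℝ (Fin d) :=
  fun τ => Z (s + τ * (t - s))

/-- Vertices extended to all of `ℕ` (clamped at `n`). -/
def vtx {n : ℕ} (v : Fin (n+1) → EuclideanSpace ℝ (Fin d)) (i : ℕ) :
    EuclideanSpace ℝ (Fin d) :=
  v ⟨min i n, Nat.lt_succ_of_le (min_le_right i n)⟩

/-- The uniformly parameterized polygonal curve through the vertices `v 0, …, v n`. -/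
def polyCurve {n : ℕ} (v : Fin (n+1) → EuclideanSpace ℝ (Fin d)) :
    ℝ → EuclideanSpace ℝ (Fin d) :=
  fun t =>
    (1 - (t * n - ⌊t * n⌋₊)) • vtx v ⌊t * n⌋₊ + (t * n - ⌊t * n⌋₊) • vtx v (⌊t * n⌋₊ + 1)

/-- Concatenation of two curves (sharing an endpoint). -/
def concat (A B : ℝ → EuclideanSpace ℝ (Fin d)) : ℝ → EuclideanSpace ℝ (Fin d) :=
  fun t => if t ≤ 1/2 then A (2 * t) else B (2 * t - 1)

/-- Concatenation of a finite list of curves. -/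
def concatList : List (ℝ → EuclideanSpace ℝ (Fin d)) → ℝ → EuclideanSpace ℝ (Fin d)
  | [] => fun _ => 0
  | [A] => A
  | A :: B :: rest => concat A (concatList (B :: rest))

/-- Given curves `X Y`, the price of the tunnel from `a` to `b` (points of `[0,1]²`):
the Fréchet distance between the subcurve `X[a.1, b.1]` and the segment from
`Y a.2` to `Y b.2`. -/
def tunnelPrice (X Y : ℝ → EuclideanSpace ℝ (Fin d)) (a b : ℝ × ℝ) : ℝ :=
  frechetDist (subcurve X a.1 b.1) (seg (Y a.2) (Y b.2))

open Classical in
/-- Indices of marked vertices in the greedy `μ`-simplification of the polygonal curve with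
vertices `v 0, …, v n`:  start at vertex `0`; repeatedly jump to the first later vertex at
distance at least `μ` from the current one; finally also mark the last vertex `n`
(the sequence stabilizes at `n`). -/
def simplIdx (v : ℕ → EuclideanSpace ℝ (Fin d)) (μ : ℝ) (n : ℕ) : ℕ → ℕ
  | 0 => 0
  | k+1 =>
    if h : ∃ j, simplIdx v μ n k < j ∧ j ≤ n ∧ μ ≤ ‖v j - v (simplIdx v μ n k)‖
    then Nat.find h
    else n

/-- The vertices of the `μ`-simplification (with the final vertex repeated). -/
def simplVerts {n : ℕ} (v : Fin (n+1) → EuclideanSpace ℝ (Fin d)) (μ : ℝ) :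
    Fin (n+1) → EuclideanSpace ℝ (Fin d) :=
  fun k => vtx v (simplIdx (vtx v) μ n k.val)

/-- The `μ`-simplification `simpl(X, μ)` of the polygonal curve with vertices
`v 0, …, v n`: the polygonal curve through the marked vertices, in order. -/
def simpl {n : ℕ} (v : Fin (n+1) → EuclideanSpace ℝ (Fin d)) (μ : ℝ) :
    ℝ → EuclideanSpace ℝ (Fin d) :=
  polyCurve (simplVerts v μ)

/-- `y` is the parameter of a vertex of a (uniformly parameterized) polygonal curve
with `n` edges. -/
def vertexParam (n : ℕ) (y : ℝ) : Prop := ∃ i : Fin (n+1), y = ((i : ℕ) : ℝ) / n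

/-- The shortcut curve of `Y` determined by the list of shortcut parameter pairs,
starting from parameter `a`. -/
def shortcutFrom (Y : ℝ → EuclideanSpace ℝ (Fin d)) :
    List (ℝ × ℝ) → ℝ → ℝ → EuclideanSpace ℝ (Fin d)
  | [], a => subcurve Y a 1
  | (y₁, y₂) :: rest, a =>
      concat (subcurve Y a y₁) (concat (seg (Y y₁) (Y y₂)) (shortcutFrom Y rest y₂))

/-- The shortcut parameter pairs form a nondecreasing sequence inside `[0,1]` and all
parameters are vertices of the polygonal curve with `n` edges. -/
def ValidShortcuts (n : ℕ) (L : List (ℝ × ℝ)) : Prop :=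
  List.Chain' (· ≤ ·) ((0:ℝ) :: (L.flatMap fun p => [p.1, p.2]) ++ [1]) ∧
  ∀ p ∈ L, vertexParam n p.1 ∧ vertexParam n p.2

/-- The directed vertex-restricted `k`-shortcut Fréchet distance between a curve `X` and the
polygonal curve with vertices `w 0, …, w n`: the infimum of the Fréchet distance between `X`
and any vertex-restricted shortcut curve of `polyCurve w` with at most `k` shortcuts. -/
def shortcutFrechetDist {n : ℕ} (X : ℝ → EuclideanSpace ℝ (Fin d))
    (w : Fin (n+1) → EuclideanSpace ℝ (Fin d)) (k : ℕ) : ℝ :=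
  sInf {r | ∃ L : List (ℝ × ℝ), L.length ≤ k ∧ ValidShortcuts n L ∧
    r = frechetDist X (shortcutFrom (polyCurve w) L 0)}

/-- The directed vertex-restricted shortcut Fréchet distance (unbounded number of
shortcuts). -/
def shortcutFrechetDistUnbounded {n : ℕ} (X : ℝ → EuclideanSpace ℝ (Fin d))
    (w : Fin (n+1) → EuclideanSpace ℝ (Fin d)) : ℝ :=
  sInf {r | ∃ L : List (ℝ × ℝ), ValidShortcuts n L ∧
    r = frechetDist X (shortcutFrom (polyCurve w) L 0)}

/-! ### Reparameterizations and weakly monotone matchings -/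

theorem IsReparam.of_strictMono {f : ℝ → ℝ} (hc : Continuous f) (hm : StrictMono f)
    (h0 : f 0 = 0) (h1 : f 1 = 1) : IsReparam f where
  contOn := hc.continuousOn
  strictMonoOn := hm.strictMonoOn _
  mapsTo := fun x hx => ⟨h0 ▸ hm.monotone hx.1, h1 ▸ hm.monotone hx.2⟩
  surjOn := by
    have := intermediate_value_Icc (zero_le_one (α := ℝ)) hc.continuousOn
    rwa [h0, h1] at this
  map_zero := h0
  map_one := h1

theorem frechetWidth_nonneg (X Y : ℝ → EuclideanSpace ℝ (Fin d)) (f : ℝ → ℝ) :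
    0 ≤ frechetWidth X Y f :=
  Real.iSup_nonneg fun _ => norm_nonneg _

theorem frechetDist_nonneg (X Y : ℝ → EuclideanSpace ℝ (Fin d)) : 0 ≤ frechetDist X Y := by
  refine Real.sInf_nonneg ?_
  rintro _ ⟨f, -, rfl⟩
  exact frechetWidth_nonneg X Y f

theorem frechetDist_le_frechetWidth (X Y : ℝ → EuclideanSpace ℝ (Fin d)) {f : ℝ → ℝ}
    (hf : IsReparam f) : frechetDist X Y ≤ frechetWidth X Y f := by
  refine csInf_le ⟨0, ?_⟩ ⟨f, hf, rfl⟩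
  rintro _ ⟨f, -, rfl⟩
  exact frechetWidth_nonneg X Y f

/-- The perturbation `(1 - ε) φ + ε id`, which makes a weakly monotone `φ` strictly monotone. -/
def perturb (ε : ℝ) (φ : ℝ → ℝ) : ℝ → ℝ := fun r => (1 - ε) * φ r + ε * r

theorem perturb_continuous {ε : ℝ} {φ : ℝ → ℝ} (hφ : Continuous φ) :
    Continuous (perturb ε φ) := by
  unfold perturb
  fun_prop

theorem perturb_strictMono {ε : ℝ} (hε : 0 < ε) (hε1 : ε ≤ 1) {φ : ℝ → ℝ} (hφ : Monotone φ) :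
    StrictMono (perturb ε φ) := by
  intro x y hxy
  have h1 := mul_le_mul_of_nonneg_left (hφ hxy.le) (sub_nonneg.2 hε1)
  have h2 := mul_lt_mul_of_pos_left hxy hε
  simp only [perturb]
  linarith

theorem perturb_surjective {ε : ℝ} (hε : 0 < ε) (hε1 : ε ≤ 1) {φ : ℝ → ℝ}
    (hc : Continuous φ) (hm : Monotone φ) : Function.Surjective (perturb ε φ) := by
  intro y
  have hε0 : (0:ℝ) ≤ 1 - ε := sub_nonneg.2 hε1
  set M := |y - (1 - ε) * φ 0| / ε with hM
  have hM0 : 0 ≤ M := by positivity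
  have hMε : ε * M = |y - (1 - ε) * φ 0| := by rw [hM]; field_simp
  have hlo : perturb ε φ (-M) ≤ y := by
    have := mul_le_mul_of_nonneg_left (hm (neg_nonpos.2 hM0)) hε0
    have := neg_abs_le (y - (1 - ε) * φ 0)
    simp only [perturb]
    linarith
  have hhi : y ≤ perturb ε φ M := by
    have := mul_le_mul_of_nonneg_left (hm hM0) hε0
    have := le_abs_self (y - (1 - ε) * φ 0)
    simp only [perturb]
    linarith
  obtain ⟨x, -, hx⟩ := intermediate_value_Icc (by linarith : -M ≤ M)
    (perturb_continuous (ε := ε) hc).continuousOn ⟨hlo, hhi⟩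
  exact ⟨x, hx⟩

theorem abs_perturb_sub_le {ε : ℝ} (hε : 0 ≤ ε) {φ : ℝ → ℝ} {r : ℝ} (hr : r ∈ Icc (0:ℝ) 1)
    (hφ : φ r ∈ Icc (0:ℝ) 1) : |perturb ε φ r - φ r| ≤ ε := by
  have : perturb ε φ r - φ r = ε * (r - φ r) := by simp only [perturb]; ring
  rw [this, abs_mul, abs_of_nonneg hε]
  have : |r - φ r| ≤ 1 := by
    rw [abs_le]
    constructor <;> linarith [hr.1, hr.2, hφ.1, hφ.2]
  nlinarith

theorem mem_Icc_of_monotone {φ : ℝ → ℝ} (hm : Monotone φ) {a b r : ℝ} (h0 : φ 0 = a)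
    (h1 : φ 1 = b) (hr : r ∈ Icc (0:ℝ) 1) : φ r ∈ Icc a b :=
  ⟨h0 ▸ hm hr.1, h1 ▸ hm hr.2⟩

/-- A pair of weakly monotone parameterizations bounds the Fréchet distance. -/
theorem frechetDist_le_of_monotone {X Y : ℝ → EuclideanSpace ℝ (Fin d)}
    (hX : ContinuousOn X (Icc 0 1)) (hY : ContinuousOn Y (Icc 0 1)) {φ ψ : ℝ → ℝ} {w : ℝ}
    (hφc : Continuous φ) (hφm : Monotone φ) (hφ0 : φ 0 = 0) (hφ1 : φ 1 = 1)
    (hψc : Continuous ψ) (hψm : Monotone ψ) (hψ0 : ψ 0 = 0) (hψ1 : ψ 1 = 1)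
    (hw : ∀ r ∈ Icc (0:ℝ) 1, ‖X (φ r) - Y (ψ r)‖ ≤ w) : frechetDist X Y ≤ w := by
  refine le_of_forall_pos_le_add fun η hη => ?_
  obtain ⟨δ₁, hδ₁, hX'⟩ := Metric.uniformContinuousOn_iff.1
    (isCompact_Icc.uniformContinuousOn_of_continuous hX) (η / 2) (by positivity)
  obtain ⟨δ₂, hδ₂, hY'⟩ := Metric.uniformContinuousOn_iff.1
    (isCompact_Icc.uniformContinuousOn_of_continuous hY) (η / 2) (by positivity)
  obtain ⟨ε, hε, hεlt⟩ := exists_between (lt_min (lt_min hδ₁ hδ₂) one_pos)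
  obtain ⟨⟨hε₁, hε₂⟩, hε1⟩ : (ε < δ₁ ∧ ε < δ₂) ∧ ε < 1 := by simpa [lt_min_iff] using hεlt
  have p0 : ∀ {χ : ℝ → ℝ}, χ 0 = 0 → perturb ε χ 0 = 0 := fun h => by simp [perturb, h]
  have p1 : ∀ {χ : ℝ → ℝ}, χ 1 = 1 → perturb ε χ 1 = 1 := fun h => by simp [perturb, h]
  have sm : ∀ {χ : ℝ → ℝ}, Monotone χ → StrictMono (perturb ε χ) :=
    fun h => perturb_strictMono hε hε1.le h
  let g : ℝ ≃o ℝ := (sm hψm).orderIsoOfSurjective _ (perturb_surjective hε hε1.le hψc hψm)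
  have hg : ∀ r, g r = perturb ε ψ r := fun _ => rfl
  have hg0 : g.symm 0 = 0 := by rw [g.symm_apply_eq, hg, p0 hψ0]
  have hg1 : g.symm 1 = 1 := by rw [g.symm_apply_eq, hg, p1 hψ1]
  have hf : IsReparam (fun t => perturb ε φ (g.symm t)) :=
    .of_strictMono ((perturb_continuous hφc).comp g.symm.continuous)
      ((sm hφm).comp g.symm.strictMono) (by rw [hg0, p0 hφ0]) (by rw [hg1, p1 hφ1])
  refine (frechetDist_le_frechetWidth X Y hf).trans (ciSup_le fun ⟨t, ht⟩ => ?_)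
  obtain ⟨r, rfl⟩ := g.surjective t
  have hr : r ∈ Icc (0:ℝ) 1 := by
    have h := mem_Icc_of_monotone g.symm.monotone hg0 hg1 ht
    rwa [g.symm_apply_apply] at h
  dsimp only
  rw [g.symm_apply_apply, hg]
  have hφr := mem_Icc_of_monotone hφm hφ0 hφ1 hr
  have hψr := mem_Icc_of_monotone hψm hψ0 hψ1 hr
  have eX := hX' _ (mem_Icc_of_monotone (sm hφm).monotone (p0 hφ0) (p1 hφ1) hr) _ hφr
    (by rw [Real.dist_eq]; exact (abs_perturb_sub_le hε.le hr hφr).trans_lt hε₁)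
  have eY := hY' _ (mem_Icc_of_monotone (sm hψm).monotone (p0 hψ0) (p1 hψ1) hr) _ hψr
    (by rw [Real.dist_eq]; exact (abs_perturb_sub_le hε.le hr hψr).trans_lt hε₂)
  have e := hw r hr
  rw [← dist_eq_norm] at e ⊢
  have := dist_triangle4_right (X (perturb ε φ r)) (Y (perturb ε ψ r)) (X (φ r)) (Y (ψ r))
  linarith

/-- `X` on `[a, b]` and `Y` on `[c, e]` can be traversed simultaneously, both weakly
monotonically, at distance at most `w`. -/
def Matched (X Y : ℝ → EuclideanSpace ℝ (Fin d)) (a b c e w : ℝ) : Prop :=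
  ∃ φ ψ : ℝ → ℝ, (Continuous φ ∧ Monotone φ ∧ φ 0 = a ∧ φ 1 = b) ∧
    (Continuous ψ ∧ Monotone ψ ∧ ψ 0 = c ∧ ψ 1 = e) ∧
    ∀ r ∈ Icc (0:ℝ) 1, ‖X (φ r) - Y (ψ r)‖ ≤ w

theorem continuousOn_subcurve {X : ℝ → EuclideanSpace ℝ (Fin d)} {a b : ℝ} (hab : a ≤ b)
    (hX : ContinuousOn X (Icc a b)) : ContinuousOn (subcurve X a b) (Icc 0 1) := by
  refine hX.comp (by fun_prop) fun r hr => ⟨?_, ?_⟩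
  · nlinarith [hr.1]
  · nlinarith [hr.2]

theorem exists_unit_parameterization {φ : ℝ → ℝ} {a b : ℝ} (hc : Continuous φ)
    (hm : Monotone φ) (h0 : φ 0 = a) (h1 : φ 1 = b) :
    ∃ χ : ℝ → ℝ, Continuous χ ∧ Monotone χ ∧ χ 0 = 0 ∧ χ 1 = 1 ∧
      ∀ r ∈ Icc (0:ℝ) 1, a + χ r * (b - a) = φ r := by
  have hab : a ≤ b := h0 ▸ h1 ▸ hm zero_le_one
  rcases hab.eq_or_lt with rfl | hlt
  · refine ⟨id, continuous_id, monotone_id, rfl, rfl, fun r hr => ?_⟩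
    have := mem_Icc_of_monotone hm h0 h1 hr
    simp only [Icc_self, mem_singleton_iff] at this
    simp [this]
  · have hpos : 0 < b - a := sub_pos.2 hlt
    refine ⟨fun r => (φ r - a) / (b - a), by fun_prop, fun x y hxy => ?_, by simp [h0],
      by simp [h1, hpos.ne'], fun r _ => by field_simp; ring⟩
    have := hm hxy
    dsimp only
    gcongr

theorem Matched.frechetDist_le {X Y : ℝ → EuclideanSpace ℝ (Fin d)} {a b c e w : ℝ}
    (h : Matched X Y a b c e w) (hX : ContinuousOn X (Icc a b))
    (hY : ContinuousOn Y (Icc c e)) :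
    frechetDist (subcurve X a b) (subcurve Y c e) ≤ w := by
  obtain ⟨φ, ψ, ⟨hφc, hφm, hφ0, hφ1⟩, ⟨hψc, hψm, hψ0, hψ1⟩, hw⟩ := h
  obtain ⟨φ', h1, h2, h3, h4, h5⟩ := exists_unit_parameterization hφc hφm hφ0 hφ1
  obtain ⟨ψ', k1, k2, k3, k4, k5⟩ := exists_unit_parameterization hψc hψm hψ0 hψ1
  refine frechetDist_le_of_monotone
    (continuousOn_subcurve (hφ0 ▸ hφ1 ▸ hφm zero_le_one) hX)
    (continuousOn_subcurve (hψ0 ▸ hψ1 ▸ hψm zero_le_one) hY) h1 h2 h3 h4 k1 k2 k3 k4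
    fun r hr => ?_
  simp only [subcurve, h5 r hr, k5 r hr]
  exact hw r hr

theorem Matched.of_frechetDist_lt {X Y : ℝ → EuclideanSpace ℝ (Fin d)} {a b c e w : ℝ}
    (hab : a ≤ b) (hce : c ≤ e) (hX : ContinuousOn X (Icc a b))
    (hY : ContinuousOn Y (Icc c e))
    (h : frechetDist (subcurve X a b) (subcurve Y c e) < w) : Matched X Y a b c e w := by
  obtain ⟨_, ⟨f, hf, rfl⟩, hfw⟩ := exists_lt_of_csInf_lt
    (by exact ⟨_, id, .of_strictMono continuous_id strictMono_id rfl rfl, rfl⟩) h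
  have hproj : ∀ r : ℝ, max 0 (min 1 r) ∈ Icc (0:ℝ) 1 :=
    fun r => ⟨le_max_left _ _, max_le zero_le_one (min_le_left _ _)⟩
  have hmono : Monotone fun r => f (max 0 (min 1 r)) := fun x y hxy =>
    hf.strictMonoOn.monotoneOn (hproj x) (hproj y) (by gcongr)
  have hcont : Continuous fun r => f (max 0 (min 1 r)) :=
    hf.contOn.comp_continuous (by fun_prop) hproj
  refine ⟨fun r => a + f (max 0 (min 1 r)) * (b - a), fun r => c + r * (e - c),
    ⟨(hcont.mul_const _).const_add a, fun x y hxy => ?_, by simp [hf.map_zero],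
      by simp [hf.map_one]⟩,
    ⟨by fun_prop, fun x y hxy => ?_, by simp, by simp⟩, fun r hr => ?_⟩
  · have := mul_le_mul_of_nonneg_right (hmono hxy) (sub_nonneg.2 hab)
    dsimp only at this ⊢
    linarith
  · have := mul_le_mul_of_nonneg_right hxy (sub_nonneg.2 hce)
    dsimp only
    linarith
  · have hb : BddAbove (range fun t : Icc (0:ℝ) 1 =>
        ‖subcurve X a b (f t) - subcurve Y c e t‖) := by
      have hco : ContinuousOn (fun t => ‖subcurve X a b (f t) - subcurve Y c e t‖)
          (Icc 0 1) :=
        (((continuousOn_subcurve hab hX).comp hf.contOn hf.mapsTo).sub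
          (continuousOn_subcurve hce hY)).norm
      have := isCompact_Icc.bddAbove_image hco
      rwa [image_eq_range] at this
    have := (le_ciSup hb ⟨r, hr⟩).trans hfw.le
    simpa [subcurve, hr.1, hr.2] using this

theorem Matched.trans {X Y : ℝ → EuclideanSpace ℝ (Fin d)} {a b b' c e e' w : ℝ}
    (h : Matched X Y a b c e w) (h' : Matched X Y b b' e e' w) :
    Matched X Y a b' c e' w := by
  obtain ⟨φ, ψ, ⟨hφc, hφm, hφ0, hφ1⟩, ⟨hψc, hψm, hψ0, hψ1⟩, hw⟩ := h
  obtain ⟨φ', ψ', ⟨hφc', hφm', hφ0', hφ1'⟩, ⟨hψc', hψm', hψ0', hψ1'⟩, hw'⟩ := h'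
  have hm : ∀ {f g : ℝ → ℝ} (k : ℝ), Monotone f → Monotone g →
      Monotone fun r => f (min 1 (2 * r)) + g (max 0 (2 * r - 1)) - k := by
    intro f g k hf hg x y hxy
    have h1 : f (min 1 (2 * x)) ≤ f (min 1 (2 * y)) := hf (by gcongr)
    have h2 : g (max 0 (2 * x - 1)) ≤ g (max 0 (2 * y - 1)) := hg (by gcongr)
    dsimp only
    linarith
  refine ⟨fun r => φ (min 1 (2 * r)) + φ' (max 0 (2 * r - 1)) - b,
    fun r => ψ (min 1 (2 * r)) + ψ' (max 0 (2 * r - 1)) - e,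
    ⟨by fun_prop, hm b hφm hφm', by simp [hφ0, hφ0'], ?_⟩,
    ⟨by fun_prop, hm e hψm hψm', by simp [hψ0, hψ0'], ?_⟩, fun r hr => ?_⟩
  · norm_num [hφ1, hφ1']
  · norm_num [hψ1, hψ1']
  · rcases le_total r (1 / 2) with hr2 | hr2
    · have e1 : min 1 (2 * r) = 2 * r := min_eq_right (by linarith)
      have e2 : max 0 (2 * r - 1) = 0 := max_eq_left (by linarith)
      simp only [e1, e2, hφ0', hψ0', add_sub_cancel_right]
      exact hw _ ⟨by linarith [hr.1], by linarith⟩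
    · have e1 : min 1 (2 * r) = 1 := min_eq_left (by linarith)
      have e2 : max 0 (2 * r - 1) = 2 * r - 1 := max_eq_right (by linarith)
      simp only [e1, e2, hφ1, hψ1, add_sub_cancel_left]
      exact hw' _ ⟨by linarith, by linarith [hr.2]⟩

theorem Matched.norm_left_le {X Y : ℝ → EuclideanSpace ℝ (Fin d)} {a b c e w : ℝ}
    (h : Matched X Y a b c e w) : ‖X a - Y c‖ ≤ w := by
  obtain ⟨φ, ψ, ⟨-, -, rfl, -⟩, ⟨-, -, rfl, -⟩, hw⟩ := h
  exact hw 0 (by simp)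

theorem Matched.norm_right_le {X Y : ℝ → EuclideanSpace ℝ (Fin d)} {a b c e w : ℝ}
    (h : Matched X Y a b c e w) : ‖X b - Y e‖ ≤ w := by
  obtain ⟨φ, ψ, ⟨-, -, -, rfl⟩, ⟨-, -, -, rfl⟩, hw⟩ := h
  exact hw 1 (by simp)

theorem Matched.restrict {X Y : ℝ → EuclideanSpace ℝ (Fin d)} {a b c e w a' b' : ℝ}
    (h : Matched X Y a b c e w) (ha : a ≤ a') (hab : a' ≤ b') (hb : b' ≤ b) :
    ∃ c' e', c ≤ c' ∧ c' ≤ e' ∧ e' ≤ e ∧ Matched X Y a' b' c' e' w := by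
  obtain ⟨φ, ψ, ⟨hφc, hφm, rfl, rfl⟩, ⟨hψc, hψm, rfl, rfl⟩, hw⟩ := h
  obtain ⟨r, hr, rfl⟩ := intermediate_value_Icc zero_le_one hφc.continuousOn
    ⟨ha, hab.trans hb⟩
  obtain ⟨r', hr', rfl⟩ := intermediate_value_Icc hr.2 hφc.continuousOn ⟨hab, hb⟩
  have haff : Monotone fun x : ℝ => r + x * (r' - r) := fun x y hxy => by
    have := mul_le_mul_of_nonneg_right hxy (sub_nonneg.2 hr'.1)
    dsimp only
    linarith
  refine ⟨ψ r, ψ r', hψm hr.1, hψm hr'.1, hψm hr'.2, fun x => φ (r + x * (r' - r)),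
    fun x => ψ (r + x * (r' - r)), ⟨by fun_prop, hφm.comp haff, by simp, by simp⟩,
    ⟨by fun_prop, hψm.comp haff, by simp, by simp⟩, fun x hx => hw _ ?_⟩
  have := mem_Icc_of_monotone haff (a := r) (b := r') (by simp) (by simp) hx
  exact ⟨hr.1.trans this.1, this.2.trans hr'.2⟩

/-- Two curves that are affine on the given intervals are matched as soon as their endpoints
are close. -/
theorem Matched.of_affine {X Y : ℝ → EuclideanSpace ℝ (Fin d)} {a b c e w : ℝ}
    (hab : a ≤ b) (hce : c ≤ e)
    (hX : ∀ r ∈ Icc (0:ℝ) 1, X (a + r * (b - a)) = (1 - r) • X a + r • X b)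
    (hY : ∀ r ∈ Icc (0:ℝ) 1, Y (c + r * (e - c)) = (1 - r) • Y c + r • Y e)
    (h0 : ‖X a - Y c‖ ≤ w) (h1 : ‖X b - Y e‖ ≤ w) : Matched X Y a b c e w := by
  have hm : ∀ {x y : ℝ}, x ≤ y → Monotone fun r => x + r * (y - x) := fun hxy p q hpq => by
    have := mul_le_mul_of_nonneg_right hpq (sub_nonneg.2 hxy)
    dsimp only
    linarith
  refine ⟨fun r => a + r * (b - a), fun r => c + r * (e - c),
    ⟨by fun_prop, hm hab, by simp, by simp⟩, ⟨by fun_prop, hm hce, by simp, by simp⟩,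
    fun r hr => ?_⟩
  dsimp only
  rw [hX r hr, hY r hr]
  have hr1 : 0 ≤ 1 - r := sub_nonneg.2 hr.2
  calc ‖(1 - r) • X a + r • X b - ((1 - r) • Y c + r • Y e)‖
      = ‖(1 - r) • (X a - Y c) + r • (X b - Y e)‖ := by congr 1; module
    _ ≤ (1 - r) * ‖X a - Y c‖ + r * ‖X b - Y e‖ := by
      refine (norm_add_le _ _).trans_eq ?_
      rw [norm_smul, norm_smul, Real.norm_of_nonneg hr1, Real.norm_of_nonneg hr.1]
    _ ≤ (1 - r) * w + r * w := by
      have := hr.1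
      gcongr
    _ = w := by ring

/-! ### Segments and polygonal curves -/

theorem seg_eq_subcurve (u v : EuclideanSpace ℝ (Fin d)) (s t : ℝ) :
    seg (u + s • (v - u)) (u + t • (v - u)) = subcurve (seg u v) s t := by
  ext1 τ
  simp only [seg, subcurve]
  module

theorem subcurve_zero_one (Y : ℝ → EuclideanSpace ℝ (Fin d)) : subcurve Y 0 1 = Y := by
  ext1 τ
  simp [subcurve]

theorem continuous_seg (u v : EuclideanSpace ℝ (Fin d)) : Continuous (seg u v) := by
  unfold seg
  fun_prop

theorem seg_affine (u v : EuclideanSpace ℝ (Fin d)) (c e r : ℝ) :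
    seg u v (c + r * (e - c)) = (1 - r) • seg u v c + r • seg u v e := by
  simp only [seg]
  module

theorem polyCurve_div {n : ℕ} (hn : 0 < n) (z : Fin (n+1) → EuclideanSpace ℝ (Fin d)) (k : ℕ)
    {x : ℝ} (hx : x ∈ Icc (k:ℝ) (k + 1)) :
    polyCurve z (x / n) = (1 - (x - k)) • vtx z k + (x - k) • vtx z (k + 1) := by
  have hn' : (n:ℝ) ≠ 0 := by positivity
  simp only [polyCurve, div_mul_cancel₀ x hn']
  rcases hx.2.eq_or_lt with h | h
  · have hfl : ⌊x⌋₊ = k + 1 := by rw [h]; exact_mod_cast Nat.floor_natCast (k + 1)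
    rw [hfl, h]
    push_cast
    simp
  · have hfl : ⌊x⌋₊ = k := (Nat.floor_eq_iff (k.cast_nonneg.trans hx.1)).2 ⟨hx.1, h⟩
    rw [hfl]

theorem continuousOn_polyCurve_div {n : ℕ} (hn : 0 < n)
    (z : Fin (n+1) → EuclideanSpace ℝ (Fin d)) (N : ℕ) :
    ContinuousOn (fun x : ℝ => polyCurve z (x / n)) (Icc 0 N) := by
  induction N with
  | zero => simp
  | succ N ih =>
    have h : ContinuousOn (fun x : ℝ => polyCurve z (x / n)) (Icc N (N + 1)) := by
      refine ContinuousOn.congr (f := fun x : ℝ => (1 - (x - N)) • vtx z N +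
        (x - N) • vtx z (N + 1)) (by fun_prop) fun x hx => polyCurve_div hn z N hx
    have := ih.union_of_isClosed h isClosed_Icc isClosed_Icc
    rw [Icc_union_Icc_eq_Icc (by positivity) (by linarith)] at this
    exact_mod_cast this

theorem continuousOn_polyCurve {n : ℕ} (hn : 0 < n)
    (z : Fin (n+1) → EuclideanSpace ℝ (Fin d)) : ContinuousOn (polyCurve z) (Icc 0 1) := by
  have hn' : (0:ℝ) < n := by positivity
  have := (continuousOn_polyCurve_div hn z n).comp (f := fun t : ℝ => t * n) (s := Icc 0 1)
    (by fun_prop) fun t ht => ⟨mul_nonneg ht.1 hn'.le, mul_le_of_le_one_left hn'.le ht.2⟩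
  refine this.congr fun t _ => ?_
  simp [hn'.ne']

theorem polyCurve_affine {n : ℕ} (hn : 0 < n) (z : Fin (n+1) → EuclideanSpace ℝ (Fin d))
    (k : ℕ) {x y : ℝ} (hx : x ∈ Icc (k:ℝ) (k + 1)) (hy : y ∈ Icc (k:ℝ) (k + 1)) {r : ℝ}
    (hr : r ∈ Icc (0:ℝ) 1) :
    polyCurve z (x / n + r * (y / n - x / n)) =
      (1 - r) • polyCurve z (x / n) + r • polyCurve z (y / n) := by
  have hxy : x / n + r * (y / n - x / n) = ((1 - r) • x + r • y) / n := by
    simp only [smul_eq_mul]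
    ring
  rw [hxy, polyCurve_div hn z k hx, polyCurve_div hn z k hy, polyCurve_div hn z k
    (convex_Icc _ _ hx hy (sub_nonneg.2 hr.2) hr.1 (by ring))]
  simp only [smul_eq_mul]
  module

theorem infDist_le_of_polyCurve {n : ℕ} (hn : 0 < n)
    (z : Fin (n+1) → EuclideanSpace ℝ (Fin d)) {k : ℕ} (hk : 1 ≤ k) (hkn : k ≤ n)
    {s : ℝ} (hs : s ∈ Icc (0:ℝ) 1) (u : EuclideanSpace ℝ (Fin d)) :
    Metric.infDist u (segment ℝ (z ⟨k - 1, by omega⟩) (z ⟨k, by omega⟩)) ≤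
      ‖polyCurve z (((k:ℝ) - 1 + s) / n) - u‖ := by
  obtain ⟨m, rfl⟩ : ∃ m, k = m + 1 := ⟨k - 1, by omega⟩
  rw [← dist_eq_norm, dist_comm]
  refine Metric.infDist_le_dist_of_mem ?_
  rw [show ((m + 1 : ℕ):ℝ) - 1 + s = m + s by push_cast; ring,
    polyCurve_div hn z m ⟨by linarith [hs.1], by linarith [hs.2]⟩]
  have hz1 : vtx z m = z ⟨m + 1 - 1, by omega⟩ := by
    simp only [vtx]; congr 2; omega
  have hz2 : vtx z (m + 1) = z ⟨m + 1, by omega⟩ := by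
    simp only [vtx]; congr 2; omega
  rw [hz1, hz2, add_sub_cancel_left]
  exact ⟨1 - s, s, sub_nonneg.2 hs.2, hs.1, by ring, rfl⟩

/-- With the setup of the canonical tunnel price
`π* = max(dist(u, e_i), α, dist(v, e_j))`: for any feasible tunnel for `δ` — i.e. points
`p = Z(((i-1)+sp)/n)` on the edge `e_i` and `q = Z(((j-1)+sq)/n)` on the edge `e_j` with
`‖p − u‖ ≤ δ` and `‖q − v‖ ≤ δ` — (i) if `δ ≤ π*` then the Fréchet distance between the
subcurve of `Z` from `p` to `q` and the segment `uv` is exactly `π*`; and (ii) if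
`δ > π*` then this Fréchet distance is at most `δ`. -/
theorem frechetDist_feasible_tunnel {d n : ℕ} (z : Fin (n+1) → EuclideanSpace ℝ (Fin d))
    (i j : ℕ) (hi : 1 ≤ i) (hij : i < j) (hj : j ≤ n)
    (u v : EuclideanSpace ℝ (Fin d)) (δ : ℝ) (hδ : 0 ≤ δ)
    (sp sq : ℝ) (hsp : sp ∈ Icc (0:ℝ) 1) (hsq : sq ∈ Icc (0:ℝ) 1)
    (hpu : ‖polyCurve z (((i:ℝ) - 1 + sp) / n) - u‖ ≤ δ)
    (hqv : ‖polyCurve z (((j:ℝ) - 1 + sq) / n) - v‖ ≤ δ) :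
    let α := sInf {w | ∃ s t : ℝ, 0 ≤ s ∧ s ≤ t ∧ t ≤ 1 ∧
      w = frechetDist (subcurve (polyCurve z) ((i:ℝ) / n) (((j:ℝ) - 1) / n))
            (seg (u + s • (v - u)) (u + t • (v - u)))}
    let pstar := max (Metric.infDist u (segment ℝ (z ⟨i - 1, by omega⟩) (z ⟨i, by omega⟩)))
      (max α (Metric.infDist v (segment ℝ (z ⟨j - 1, by omega⟩) (z ⟨j, by omega⟩))))
    (δ ≤ pstar →
      frechetDist
          (subcurve (polyCurve z) (((i:ℝ) - 1 + sp) / n) (((j:ℝ) - 1 + sq) / n))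
          (seg u v) = pstar) ∧
    (pstar < δ →
      frechetDist
          (subcurve (polyCurve z) (((i:ℝ) - 1 + sp) / n) (((j:ℝ) - 1 + sq) / n))
          (seg u v) ≤ δ) := by
  intro α pstar
  have hn : 0 < n := by omega
  have hn' : (0:ℝ) < n := by exact_mod_cast hn
  have hi' : (1:ℝ) ≤ i := by exact_mod_cast hi
  have hij' : (i:ℝ) + 1 ≤ j := by exact_mod_cast hij
  have hj' : (j:ℝ) ≤ n := by exact_mod_cast hj
  obtain ⟨hsp0, hsp1⟩ := hsp
  obtain ⟨hsq0, hsq1⟩ := hsq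
  set Z := polyCurve z with hZ
  set P := ((i:ℝ) - 1 + sp) / n with hP
  set I := (i:ℝ) / n with hI
  set J := ((j:ℝ) - 1) / n with hJ
  set Q := ((j:ℝ) - 1 + sq) / n with hQ
  have hP0 : 0 ≤ P := div_nonneg (by linarith) hn'.le
  have hPI : P ≤ I := by rw [hP, hI]; gcongr; linarith
  have hIJ : I ≤ J := by rw [hI, hJ]; gcongr; linarith
  have hJQ : J ≤ Q := by rw [hJ, hQ]; gcongr; linarith
  have hQ1 : Q ≤ 1 := by rw [hQ, div_le_one hn']; linarith
  have hZc : ∀ {a b : ℝ}, 0 ≤ a → b ≤ 1 → ContinuousOn Z (Icc a b) := fun ha hb =>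
    (continuousOn_polyCurve hn z).mono (Icc_subset_Icc ha hb)
  have hYc : ∀ {a b : ℝ}, ContinuousOn (seg u v) (Icc a b) :=
    (continuous_seg u v).continuousOn
  have hPQ := hPI.trans (hIJ.trans hJQ)
  have hY0 : seg u v 0 = u := by simp [seg]
  have hY1 : seg u v 1 = v := by simp [seg]
  have hα : α = sInf {w | ∃ s t : ℝ, 0 ≤ s ∧ s ≤ t ∧ t ≤ 1 ∧
      w = frechetDist (subcurve Z I J) (subcurve (seg u v) s t)} := by
    simp only [α, seg_eq_subcurve, hZ, hI, hJ]
  have hupper : frechetDist (subcurve Z P Q) (seg u v) ≤ max δ α := by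
    refine le_of_forall_gt_imp_ge_of_dense fun w hw => ?_
    obtain ⟨hδw, hαw⟩ := max_lt_iff.1 hw
    rw [hα] at hαw
    obtain ⟨_, ⟨s, t, hs, hst, ht, rfl⟩, hlt⟩ := exists_lt_of_csInf_lt
      (by exact ⟨_, 0, 0, le_rfl, le_rfl, zero_le_one, rfl⟩) hαw
    have hmid := Matched.of_frechetDist_lt hIJ hst (hZc (hP0.trans hPI) (hJQ.trans hQ1)) hYc hlt
    have hleft : Matched Z (seg u v) P I 0 s w := by
      refine .of_affine hPI hs (fun r hr => polyCurve_affine hn z (i - 1) ?_ ?_ hr)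
        (fun r _ => seg_affine u v 0 s r) (hY0.symm ▸ hpu.trans hδw.le) hmid.norm_left_le <;>
      · push_cast [Nat.cast_sub hi]
        constructor <;> linarith
    have hright : Matched Z (seg u v) J Q t 1 w := by
      refine .of_affine hJQ ht (fun r hr => polyCurve_affine hn z (j - 1) ?_ ?_ hr)
        (fun r _ => seg_affine u v t 1 r) hmid.norm_right_le (hY1.symm ▸ hqv.trans hδw.le) <;>
      · push_cast [Nat.cast_sub (hi.trans hij.le)]
        constructor <;> linarith
    have := ((hleft.trans hmid).trans hright).frechetDist_le (hZc hP0 hQ1) hYc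
    rwa [subcurve_zero_one] at this
  have hlower : pstar ≤ frechetDist (subcurve Z P Q) (seg u v) := by
    refine le_of_forall_gt_imp_ge_of_dense fun w hw => ?_
    rw [← subcurve_zero_one (seg u v)] at hw
    have hm := Matched.of_frechetDist_lt hPQ zero_le_one (hZc hP0 hQ1) hYc hw
    have hu := hm.norm_left_le
    have hv := hm.norm_right_le
    rw [hY0] at hu
    rw [hY1] at hv
    refine max_le ?_ (max_le ?_ ?_)
    · exact (infDist_le_of_polyCurve hn z hi (hij.le.trans hj) ⟨hsp0, hsp1⟩ u).trans hu
    · obtain ⟨s, t, hs, hst, ht, hst'⟩ := hm.restrict hPI hIJ hJQ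
      rw [hα]
      refine le_trans (csInf_le ⟨0, ?_⟩ ⟨s, t, hs, hst, ht, rfl⟩)
        (hst'.frechetDist_le (hZc (hP0.trans hPI) (hJQ.trans hQ1)) hYc)
      rintro _ ⟨s, t, -, -, -, rfl⟩
      exact frechetDist_nonneg _ _
    · exact (infDist_le_of_polyCurve hn z (hi.trans hij.le) hj ⟨hsq0, hsq1⟩ v).trans hv
  have hαp : α ≤ pstar := (le_max_left _ _).trans (le_max_right _ _)
  exact ⟨fun h => le_antisymm (hupper.trans (max_le h hαp)) hlower,
    fun h => hupper.trans (max_le le_rfl (hαp.trans h.le))⟩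

end Jaywalk
end
end

section
/- Let e be a segment in ℝ^d and let u, v ∈ ℝ^d. Let R = min over r ∈ e of max(‖r − u‖, ‖r − v‖). Then there exists x in the set {dist(u, e), dist(v, e), ‖u − v‖} such that x/2 ≤ R ≤ 2x. -/
open Set

noncomputable section

namespace Jaywalk

variable {d : ℕ}

/-- Let `e = segment a b` and `R = min_{r ∈ e} max(‖r − u‖, ‖r − v‖)`.
Then some `x ∈ {dist(u,e), dist(v,e), ‖u − v‖}` satisfies `x/2 ≤ R ≤ 2x`. -/
theorem min_max_dist_approx {d : ℕ} (a b u v : EuclideanSpace ℝ (Fin d)) :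
    let R := sInf {x | ∃ r ∈ segment ℝ a b, x = max ‖r - u‖ ‖r - v‖}
    ∃ x ∈ ({Metric.infDist u (segment ℝ a b), Metric.infDist v (segment ℝ a b),
        ‖u - v‖} : Set ℝ),
      x / 2 ≤ R ∧ R ≤ 2 * x := by
  intro R
  have lower {c : ℝ} (h : ∀ r ∈ segment ℝ a b, c ≤ max ‖r - u‖ ‖r - v‖) : c ≤ R := by
    refine le_csInf ⟨_, a, left_mem_segment ℝ a b, rfl⟩ ?_
    rintro _ ⟨r, hr, rfl⟩
    exact h r hr
  have bdd : BddBelow {x | ∃ r ∈ segment ℝ a b, x = max ‖r - u‖ ‖r - v‖} := by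
    refine ⟨0, ?_⟩
    rintro _ ⟨r, -, rfl⟩
    exact le_max_of_le_left (norm_nonneg _)
  have compact : IsCompact (segment ℝ a b) := by
    rw [segment_eq_image]
    exact isCompact_Icc.image (by fun_prop)
  obtain ⟨p, hp, hpu⟩ := compact.exists_infDist_eq_dist ⟨a, left_mem_segment ℝ a b⟩ u
  have upper : R ≤ Metric.infDist u (segment ℝ a b) + ‖u - v‖ := by
    refine (csInf_le bdd ⟨p, hp, rfl⟩).trans ?_
    rw [hpu, dist_comm, dist_eq_norm]
    exact max_le (le_add_of_nonneg_right (norm_nonneg _)) (norm_sub_le_norm_sub_add_norm_sub p u v)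
  have infDist_le : Metric.infDist u (segment ℝ a b) ≤ R := lower fun r hr => by
    refine le_max_of_le_left ((Metric.infDist_le_dist_of_mem hr).trans_eq ?_)
    rw [dist_comm, dist_eq_norm]
  have half_le : ‖u - v‖ / 2 ≤ R := lower fun r _ => by
    have := norm_sub_le_norm_sub_add_norm_sub u r v
    rw [norm_sub_rev u r] at this
    linarith [le_max_left ‖r - u‖ ‖r - v‖, le_max_right ‖r - u‖ ‖r - v‖]
  have infDist_nonneg : 0 ≤ Metric.infDist u (segment ℝ a b) := Metric.infDist_nonneg
  rcases le_total ‖u - v‖ (Metric.infDist u (segment ℝ a b)) with h | h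
  · exact ⟨_, Or.inl rfl, by linarith, by linarith⟩
  · exact ⟨_, Or.inr (Or.inr rfl), half_le, by linarith⟩

end Jaywalk
end
end

section
/- Let Z be a polygonal curve in ℝ^d with vertices u_1, …, u_n, let 1 ≤ i < j ≤ n, and let Z' be the polygonal curve obtained by concatenating the subcurve of Z from u_1 to u_i, the straight segment u_i u_j, and the subcurve of Z from u_j to u_n. Then for any points p, q ∈ ℝ^d, d_F(Z', pq) ≤ d_F(Z, pq). -/
open Set

noncomputable section

namespace Jaywalk

variable {d : ℕ}

/-- A continuous strictly increasing function on `[0,1]` fixing both endpoints is a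
reparameterization. -/
theorem IsReparam.of_strictMonoOn {f : ℝ → ℝ} (hc : ContinuousOn f (Icc 0 1))
    (hm : StrictMonoOn f (Icc 0 1)) (h0 : f 0 = 0) (h1 : f 1 = 1) : IsReparam f where
  contOn := hc
  strictMonoOn := hm
  mapsTo t ht := by
    have hl := hm.monotoneOn (left_mem_Icc.2 zero_le_one) ht ht.1
    have hr := hm.monotoneOn ht (right_mem_Icc.2 zero_le_one) ht.2
    rw [h0] at hl
    rw [h1] at hr
    exact ⟨hl, hr⟩
  surjOn := by
    have h := intermediate_value_Icc zero_le_one hc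
    rwa [h0, h1] at h
  map_zero := h0
  map_one := h1

/-- A reparameterization has an inverse reparameterization, which extends to a continuous
monotone function on the whole line. -/
theorem IsReparam.exists_inverse {f : ℝ → ℝ} (hf : IsReparam f) :
    ∃ g : ℝ → ℝ, IsReparam g ∧ Continuous g ∧ Monotone g ∧ ∀ t ∈ Icc (0:ℝ) 1, f (g t) = t := by
  let F : Icc (0:ℝ) 1 → Icc (0:ℝ) 1 := hf.mapsTo.restrict f _ _
  have hF : StrictMono F := fun x y hxy => hf.strictMonoOn x.2 y.2 hxy
  have hs : Function.Surjective F := by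
    rintro ⟨y, hy⟩
    obtain ⟨x, hx, rfl⟩ := hf.surjOn hy
    exact ⟨⟨x, hx⟩, rfl⟩
  let e : Icc (0:ℝ) 1 ≃o Icc (0:ℝ) 1 := hF.orderIsoOfSurjective F hs
  let g : ℝ → ℝ := fun t => e.symm (projIcc 0 1 zero_le_one t)
  have hfg : ∀ t ∈ Icc (0:ℝ) 1, f (g t) = t := by
    intro t ht
    have h : e (e.symm (projIcc 0 1 zero_le_one t)) = projIcc 0 1 zero_le_one t :=
      e.apply_symm_apply _
    rw [projIcc_of_mem _ ht] at h
    have h' := congrArg Subtype.val h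
    simp only [g, projIcc_of_mem _ ht]
    exact h'
  have hmem : ∀ t, g t ∈ Icc (0:ℝ) 1 := fun t => (e.symm (projIcc 0 1 zero_le_one t)).2
  have hc : Continuous g :=
    continuous_subtype_val.comp (e.symm.continuous.comp continuous_projIcc)
  have hm : Monotone g := fun x y hxy => e.symm.monotone (monotone_projIcc _ hxy)
  have hsm : StrictMonoOn g (Icc 0 1) := by
    intro x hx y hy hxy
    refine (hm hxy.le).lt_of_ne fun h => hxy.ne ?_
    rw [← hfg x hx, ← hfg y hy, h]
  have h0 : (0:ℝ) ∈ Icc (0:ℝ) 1 := left_mem_Icc.2 zero_le_one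
  have h1 : (1:ℝ) ∈ Icc (0:ℝ) 1 := right_mem_Icc.2 zero_le_one
  refine ⟨g, .of_strictMonoOn hc.continuousOn hsm ?_ ?_, hc, hm, hfg⟩
  · exact hf.strictMonoOn.injOn (hmem 0) h0 ((hfg 0 h0).trans hf.map_zero.symm)
  · exact hf.strictMonoOn.injOn (hmem 1) h1 ((hfg 1 h1).trans hf.map_one.symm)

theorem seg_sub_seg (p q : EuclideanSpace ℝ (Fin d)) (s t : ℝ) :
    seg p q s - seg p q t = (s - t) • (q - p) := by
  simp only [seg]
  module

theorem seg_seg (p q : EuclideanSpace ℝ (Fin d)) (s t r : ℝ) :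
    seg (seg p q s) (seg p q t) r = seg p q (s + r * (t - s)) := by
  simp only [seg]
  module

theorem norm_seg_le {p q : EuclideanSpace ℝ (Fin d)} {M r : ℝ} (hp : ‖p‖ ≤ M) (hq : ‖q‖ ≤ M)
    (h0 : 0 ≤ r) (h1 : r ≤ 1) : ‖seg p q r‖ ≤ M := by
  have h := (convex_closedBall (0 : EuclideanSpace ℝ (Fin d)) M)
    (mem_closedBall_zero_iff.2 hp) (mem_closedBall_zero_iff.2 hq)
    (sub_nonneg.2 h1) h0 (sub_add_cancel 1 r)
  exact mem_closedBall_zero_iff.1 h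

theorem norm_seg_sub_seg_le {a b p q : EuclideanSpace ℝ (Fin d)} {M r : ℝ} (hp : ‖a - p‖ ≤ M)
    (hq : ‖b - q‖ ≤ M) (h0 : 0 ≤ r) (h1 : r ≤ 1) : ‖seg a b r - seg p q r‖ ≤ M := by
  have h : seg a b r - seg p q r = seg (a - p) (b - q) r := by
    simp only [seg]
    module
  rw [h]
  exact norm_seg_le hp hq h0 h1

/-- The Fréchet distance to a segment may be bounded by a weakly monotone matching. -/
theorem frechetDist_seg_le_of_monotone {X : ℝ → EuclideanSpace ℝ (Fin d)}
    {p q : EuclideanSpace ℝ (Fin d)} {β : ℝ → ℝ} {δ : ℝ} (hc : Continuous β) (hm : Monotone β)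
    (h0 : β 0 = 0) (h1 : β 1 = 1) (hδ : ∀ t ∈ Icc (0:ℝ) 1, ‖X t - seg p q (β t)‖ ≤ δ) :
    frechetDist X (seg p q) ≤ δ := by
  have key : ∀ ε ∈ Ioo (0:ℝ) 1, frechetDist X (seg p q) ≤ δ + ε * ‖q - p‖ := by
    intro ε hε
    have hr : IsReparam fun t => (1 - ε) * β t + ε * t := by
      refine .of_strictMonoOn (by fun_prop) (fun x _ y _ hxy => ?_) (by simp [h0]) (by simp [h1])
      have h2 := mul_le_mul_of_nonneg_left (hm hxy.le) (sub_nonneg.2 hε.2.le)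
      have h3 := mul_lt_mul_of_pos_left hxy hε.1
      exact add_lt_add_of_le_of_lt h2 h3
    obtain ⟨g, hg, -, -, hinv⟩ := hr.exists_inverse
    refine (frechetDist_le_frechetWidth _ _ hg).trans (ciSup_le ?_)
    rintro ⟨t, ht⟩
    have hs := hg.mapsTo ht
    have hβ : β (g t) ∈ Icc (0:ℝ) 1 := ⟨h0 ▸ hm hs.1, h1 ▸ hm hs.2⟩
    have hY : ‖seg p q (β (g t)) - seg p q t‖ ≤ ε * ‖q - p‖ := by
      rw [seg_sub_seg, norm_smul]
      have he : β (g t) - t = ε * (β (g t) - g t) := by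
        linear_combination hinv t ht
      have ha : |β (g t) - g t| ≤ 1 :=
        abs_le.2 ⟨by linarith [hs.2, hβ.1], by linarith [hs.1, hβ.2]⟩
      rw [he, Real.norm_eq_abs, abs_mul, abs_of_pos hε.1]
      have := mul_le_mul_of_nonneg_left ha hε.1.le
      gcongr
      linarith
    calc ‖X (g t) - seg p q t‖
        ≤ ‖X (g t) - seg p q (β (g t))‖ + ‖seg p q (β (g t)) - seg p q t‖ :=
          norm_sub_le_norm_sub_add_norm_sub _ _ _
      _ ≤ δ + ε * ‖q - p‖ := add_le_add (hδ _ hs) hY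
  have hlim : Filter.Tendsto (fun ε : ℝ => δ + ε * ‖q - p‖) (nhdsWithin 0 (Ioi 0))
      (nhds δ) := by
    have h : Continuous fun ε : ℝ => δ + ε * ‖q - p‖ := by fun_prop
    simpa using (h.tendsto 0).mono_left nhdsWithin_le_nhds
  refine ge_of_tendsto hlim ?_
  filter_upwards [Ioo_mem_nhdsGT (zero_lt_one' ℝ)] with ε hε using key ε hε

theorem polyCurve_vertex {n : ℕ} (hn : n ≠ 0) (v : Fin (n+1) → EuclideanSpace ℝ (Fin d))
    (i : Fin (n+1)) : polyCurve v (((i : ℕ) : ℝ) / n) = v i := by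
  have h : ((i : ℕ) : ℝ) / n * n = (i : ℕ) := div_mul_cancel₀ _ (Nat.cast_ne_zero.2 hn)
  have hi : min (i : ℕ) n = i := min_eq_left (Nat.le_of_lt_succ i.2)
  simp [polyCurve, h, vtx, hi]

theorem norm_polyCurve_le {n : ℕ} (v : Fin (n+1) → EuclideanSpace ℝ (Fin d)) {t : ℝ}
    (ht : 0 ≤ t) : ‖polyCurve v t‖ ≤ ∑ i, ‖v i‖ := by
  have hv : ∀ k, ‖vtx v k‖ ≤ ∑ i, ‖v i‖ := fun k =>
    Finset.single_le_sum (f := fun i => ‖v i‖) (fun _ _ => norm_nonneg _) (Finset.mem_univ _)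
  have h0 : (0:ℝ) ≤ t * n := by positivity
  exact norm_seg_le (hv _) (hv _) (sub_nonneg.2 (Nat.floor_le h0))
    (sub_le_iff_le_add'.2 (Nat.lt_floor_add_one _).le)

theorem norm_polyCurve_sub_seg_le_frechetWidth {n : ℕ}
    (v : Fin (n+1) → EuclideanSpace ℝ (Fin d)) (p q : EuclideanSpace ℝ (Fin d)) {f : ℝ → ℝ}
    (hf : IsReparam f) {t : ℝ} (ht : t ∈ Icc (0:ℝ) 1) :
    ‖polyCurve v (f t) - seg p q t‖ ≤ frechetWidth (polyCurve v) (seg p q) f := by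
  refine le_ciSup (f := fun t : Icc (0:ℝ) 1 => ‖polyCurve v (f t) - seg p q t‖) ?_ ⟨t, ht⟩
  refine ⟨(∑ i, ‖v i‖) + max ‖p‖ ‖q‖, ?_⟩
  rintro _ ⟨⟨s, hs⟩, rfl⟩
  exact (norm_sub_le _ _).trans (add_le_add (norm_polyCurve_le v (hf.mapsTo hs).1)
    (norm_seg_le (le_max_left _ _) (le_max_right _ _) hs.1 hs.2))

/-- Replacing the part of a curve between two parameters by a segment does not spoil a matching
of the curve with a segment. -/
theorem frechetDist_concat_seg_le {X : ℝ → EuclideanSpace ℝ (Fin d)}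
    {p q : EuclideanSpace ℝ (Fin d)} {f : ℝ → ℝ} (hf : IsReparam f) {δ a b : ℝ} (ha : 0 ≤ a)
    (hab : a ≤ b) (hb : b ≤ 1) (hδ : ∀ t ∈ Icc (0:ℝ) 1, ‖X (f t) - seg p q t‖ ≤ δ) :
    frechetDist (concat (subcurve X 0 a) (concat (seg (X a) (X b)) (subcurve X b 1))) (seg p q)
      ≤ δ := by
  obtain ⟨g, hg, hgc, hgm, hfg⟩ := hf.exists_inverse
  have hX : ∀ t ∈ Icc (0:ℝ) 1, ‖X t - seg p q (g t)‖ ≤ δ := by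
    intro t ht
    have h := hδ (g t) (hg.mapsTo ht)
    rwa [hfg t ht] at h
  let c : ℝ → ℝ := fun x => max 0 (min 1 x)
  have hcc : Continuous c := by fun_prop
  have hcm : Monotone c := fun x y hxy => max_le_max le_rfl (min_le_min le_rfl hxy)
  have hc0 : ∀ x ≤ 0, c x = 0 := fun x hx => max_eq_left ((min_le_right _ _).trans hx)
  have hc1 : ∀ x, 1 ≤ x → c x = 1 := fun x hx => by simp [c, min_eq_left hx]
  have hcx : ∀ x, 0 ≤ x → x ≤ 1 → c x = x := fun x h h' => by
    simp [c, min_eq_right h', max_eq_right h]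
  let β : ℝ → ℝ := fun t =>
    g (a * c (2 * t)) + c (4 * t - 2) * (g b - g a) + g (b + c (4 * t - 3) * (1 - b)) - g b
  have hgab : 0 ≤ g b - g a := sub_nonneg.2 (hgm hab)
  refine frechetDist_seg_le_of_monotone (β := β) (by fun_prop) ?_ ?_ ?_ ?_
  · intro x y hxy
    have h1 : c (2 * x) ≤ c (2 * y) := hcm (by linarith)
    have h2 : c (4 * x - 2) ≤ c (4 * y - 2) := hcm (by linarith)
    have h3 : c (4 * x - 3) ≤ c (4 * y - 3) := hcm (by linarith)
    have k1 := hgm (mul_le_mul_of_nonneg_left h1 ha)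
    have k2 := mul_le_mul_of_nonneg_right h2 hgab
    have k3 := hgm (add_le_add_right (mul_le_mul_of_nonneg_right h3 (sub_nonneg.2 hb)) b)
    simp only [β]
    linarith
  · simp [β, hc0, hg.map_zero]
  · have h1 : c (2 * 1) = 1 := hc1 _ (by norm_num)
    have h2 : c (4 * 1 - 2) = 1 := hc1 _ (by norm_num)
    have h3 : c (4 * 1 - 3) = 1 := hc1 _ (by norm_num)
    simp only [β, h1, h2, h3]
    rw [mul_one, one_mul, one_mul, add_sub_cancel, add_sub_cancel_left, add_sub_cancel, hg.map_one]
  · intro t ht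
    obtain ⟨ht0, ht1⟩ := ht
    rcases le_or_gt t (1/2) with h | h
    · have e1 : c (2 * t) = 2 * t := hcx _ (by linarith) (by linarith)
      have e2 : c (4 * t - 2) = 0 := hc0 _ (by linarith)
      have e3 : c (4 * t - 3) = 0 := hc0 _ (by linarith)
      have hβ : β t = g (2 * t * a) := by
        simp only [β, e1, e2, e3, zero_mul, add_zero, add_sub_cancel_right, mul_comm a]
      rw [hβ, concat, if_pos h, subcurve, sub_zero, zero_add]
      exact hX _ ⟨by positivity, mul_le_one₀ (by linarith) ha (hab.trans hb)⟩
    · have e1 : c (2 * t) = 1 := hc1 _ (by linarith)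
      rw [concat, if_neg h.not_ge]
      rcases le_or_gt t (3/4) with h' | h'
      · have e2 : c (4 * t - 2) = 4 * t - 2 := hcx _ (by linarith) (by linarith)
        have e3 : c (4 * t - 3) = 0 := hc0 _ (by linarith)
        have hβ : β t = g a + 2 * (2 * t - 1) * (g b - g a) := by
          simp only [β, e1, e2, e3, mul_one, zero_mul, add_zero]
          ring
        rw [hβ, concat, if_pos (by linarith), ← seg_seg]
        exact norm_seg_sub_seg_le (hX a ⟨ha, hab.trans hb⟩) (hX b ⟨ha.trans hab, hb⟩)
          (by linarith) (by linarith)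
      · have e2 : c (4 * t - 2) = 1 := hc1 _ (by linarith)
        have e3 : c (4 * t - 3) = 4 * t - 3 := hcx _ (by linarith) (by linarith)
        have hβ : β t = g (b + (2 * (2 * t - 1) - 1) * (1 - b)) := by
          have e4 : 2 * (2 * t - 1) - 1 = 4 * t - 3 := by ring
          simp only [β, e1, e2, e3, e4, mul_one, one_mul]
          ring
        rw [hβ, concat, if_neg (by linarith), subcurve]
        exact hX _ ⟨by nlinarith, by nlinarith⟩

/-- Shortcutting a polygonal curve between two of its vertices cannot
increase its Fréchet distance to a line segment. -/
theorem frechetDist_shortcut_le {d n : ℕ} (u : Fin (n+1) → EuclideanSpace ℝ (Fin d))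
    (i j : Fin (n+1)) (hij : i < j) (p q : EuclideanSpace ℝ (Fin d)) :
    frechetDist
        (concat (subcurve (polyCurve u) 0 (((i : ℕ) : ℝ) / n))
          (concat (seg (u i) (u j)) (subcurve (polyCurve u) (((j : ℕ) : ℝ) / n) 1)))
        (seg p q) ≤
      frechetDist (polyCurve u) (seg p q) := by
  have hn : n ≠ 0 := by
    rintro rfl
    omega
  have hn' : (0:ℝ) < n := Nat.cast_pos.2 (Nat.pos_of_ne_zero hn)
  refine le_csInf ⟨_, id, .of_strictMonoOn continuousOn_id strictMonoOn_id rfl rfl, rfl⟩ ?_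
  rintro _ ⟨f, hf, rfl⟩
  have h := frechetDist_concat_seg_le (X := polyCurve u) (p := p) (q := q) hf
    (a := ((i : ℕ) : ℝ) / n) (b := ((j : ℕ) : ℝ) / n) (by positivity)
    (div_le_div_of_nonneg_right (Nat.cast_le.2 hij.le) hn'.le)
    ((div_le_one hn').2 (Nat.cast_le.2 (Nat.le_of_lt_succ j.2)))
    (fun t ht => norm_polyCurve_sub_seg_le_frechetWidth u p q hf ht)
  rwa [polyCurve_vertex hn, polyCurve_vertex hn] at h

end Jaywalk
end
end

section
/- For every dimension d there is a constant C_d > 0 such that the following holds. Given a point u ∈ ℝ^d, a parameter 0 < ε ≤ 1, and an interval [α, β] ⊆ ℝ with 0 < α ≤ β, there exists a finite set G ⊆ ℝ^d of cardinality at most C_d · ε^{−d} · (1 + log(β/α)) such that for every point p ∈ ℝ^d with α ≤ ‖p − u‖ ≤ β there is a point p' ∈ G with ‖p − p'‖ ≤ (ε/2)·‖p − u‖. -/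
open Set

noncomputable section

namespace Jaywalk

variable {d : ℕ}

/-- A vector of `ℝ^d` with coordinates bounded by `c` has Euclidean norm at most `d * c`. -/
theorem norm_le_card_mul_of_forall_abs_le {c : ℝ} (hc : 0 ≤ c) (x : EuclideanSpace ℝ (Fin d))
    (hx : ∀ i, |x i| ≤ c) : ‖x‖ ≤ d * c := by
  rw [EuclideanSpace.norm_eq]
  refine Real.sqrt_le_iff.mpr ⟨by positivity, ?_⟩
  calc ∑ i, ‖x i‖ ^ 2 ≤ ∑ _i : Fin d, c ^ 2 :=
        Finset.sum_le_sum fun i _ => pow_le_pow_left₀ (norm_nonneg _) (hx i) 2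
    _ = (d : ℝ) * c ^ 2 := by simp
    _ ≤ (d : ℝ) ^ 2 * c ^ 2 := by
        gcongr
        exact_mod_cast Nat.le_self_pow two_ne_zero d
    _ = (d * c) ^ 2 := by ring

/-- A ball of radius `R` in `ℝ^d` is covered by `O(δ⁻ᵈ)` balls of radius `δ * R`. -/
theorem exists_finset_card_le_cover_closedBall (u : EuclideanSpace ℝ (Fin d)) {δ R : ℝ}
    (hδ : 0 < δ) (hδ1 : δ ≤ 1) (hR : 0 < R) :
    ∃ G : Finset (EuclideanSpace ℝ (Fin d)),
      (G.card : ℝ) ≤ ((2 * d + 5) * δ⁻¹) ^ d ∧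
      ∀ p : EuclideanSpace ℝ (Fin d), ‖p - u‖ ≤ R → ∃ p' ∈ G, ‖p - p'‖ ≤ δ * R := by
  classical
  set N : ℕ := ⌈d * δ⁻¹⌉₊ + 1 with hN
  have hNpos : (0 : ℝ) < N := by rw [hN]; positivity
  have hdN : (d : ℝ) * δ⁻¹ ≤ N := by
    rw [hN]; push_cast
    linarith [Nat.le_ceil ((d : ℝ) * δ⁻¹)]
  have hNle : (N : ℝ) ≤ d * δ⁻¹ + 2 := by
    rw [hN]; push_cast
    linarith [Nat.ceil_lt_add_one (show (0 : ℝ) ≤ d * δ⁻¹ by positivity)]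
  let node : (Fin d → ℤ) → EuclideanSpace ℝ (Fin d) :=
    fun k => u + WithLp.toLp 2 fun i => R / N * (k i : ℝ)
  refine ⟨(Fintype.piFinset fun _ => Finset.Icc (-N : ℤ) N).image node, ?_, fun p hp => ?_⟩
  · calc (((Fintype.piFinset fun _ => Finset.Icc (-N : ℤ) N).image node).card : ℝ)
        ≤ ((Fintype.piFinset fun _ : Fin d => Finset.Icc (-N : ℤ) N).card : ℝ) := by
          exact_mod_cast Finset.card_image_le
      _ = (2 * N + 1 : ℝ) ^ d := by
          have h : ((N : ℤ) + 1 - -N).toNat = 2 * N + 1 := by omega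
          rw [Fintype.card_piFinset_const, Int.card_Icc, h]
          push_cast
          simp
      _ ≤ ((2 * d + 5) * δ⁻¹) ^ d := by
          gcongr
          linarith [(one_le_inv₀ hδ).mpr hδ1]
  · have hcoord : ∀ i, |(p - u) i * (N / R)| ≤ N := fun i => by
      have h := (PiLp.norm_apply_le (p - u) i).trans hp
      rw [Real.norm_eq_abs] at h
      rw [abs_mul, abs_of_pos (div_pos hNpos hR)]
      calc |(p - u) i| * (N / R) ≤ R * (N / R) := by gcongr
        _ = N := by field_simp
    refine ⟨node fun i => ⌊(p - u) i * (N / R)⌋, Finset.mem_image_of_mem _ ?_, ?_⟩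
    · refine Fintype.mem_piFinset.mpr fun i => Finset.mem_Icc.mpr ⟨?_, ?_⟩
      · exact Int.le_floor.mpr (by push_cast; exact (abs_le.mp (hcoord i)).1)
      · refine (Int.cast_le (R := ℝ)).mp ?_
        rw [Int.cast_natCast]
        exact (Int.floor_le _).trans (abs_le.mp (hcoord i)).2
    · have h := norm_le_card_mul_of_forall_abs_le (c := R / N) (by positivity)
        (p - node fun i => ⌊(p - u) i * (N / R)⌋) fun i => by
          have e : (p - node fun i => ⌊(p - u) i * (N / R)⌋) i
              = R / N * Int.fract ((p - u) i * (N / R)) := by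
            simp only [node, Int.fract, PiLp.sub_apply, PiLp.add_apply]
            field_simp
            ring
          rw [e, abs_of_nonneg (mul_nonneg (by positivity) (Int.fract_nonneg _))]
          exact mul_le_of_le_one_right (by positivity) (Int.fract_lt_one _).le
      refine h.trans ?_
      have hd : (d : ℝ) ≤ δ * N := by
        calc (d : ℝ) = δ * (d * δ⁻¹) := by field_simp
          _ ≤ δ * N := by gcongr
      calc (d : ℝ) * (R / N) ≤ δ * N * (R / N) := by gcongr
        _ = δ * R := by field_simp

/-- Exponential grid: for every dimension `d` there is a constant
`C > 0` such that for every `u ∈ ℝ^d`, `0 < ε ≤ 1` and `0 < α ≤ β`, there is a finite set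
`G ⊆ ℝ^d` of cardinality at most `C · ε⁻ᵈ · (1 + log(β/α))` such that every point `p` with
`α ≤ ‖p − u‖ ≤ β` has a grid point `p' ∈ G` with `‖p − p'‖ ≤ (ε/2)·‖p − u‖`. -/
theorem exponential_grid (d : ℕ) :
    ∃ C : ℝ, 0 < C ∧ ∀ (u : EuclideanSpace ℝ (Fin d)) (ε α β : ℝ),
      0 < ε → ε ≤ 1 → 0 < α → α ≤ β →
      ∃ G : Finset (EuclideanSpace ℝ (Fin d)),
        (G.card : ℝ) ≤ C * ε⁻¹ ^ d * (1 + Real.log (β / α)) ∧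
        ∀ p : EuclideanSpace ℝ (Fin d), α ≤ ‖p - u‖ → ‖p - u‖ ≤ β →
          ∃ p' ∈ G, ‖p - p'‖ ≤ ε / 2 * ‖p - u‖ := by
  classical
  refine ⟨((2 * d + 5) * 6) ^ d, by positivity, fun u ε α β hε hε1 hα hαβ => ?_⟩
  have hlog : 0 ≤ Real.log (β / α) := Real.log_nonneg ((one_le_div hα).mpr hαβ)
  choose G hcard hcover using fun k : ℕ =>
    exists_finset_card_le_cover_closedBall u (δ := ε / 6) (R := Real.exp (k + 1) * α)
      (by positivity) (by linarith) (by positivity)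
  refine ⟨(Finset.range (⌊Real.log (β / α)⌋₊ + 1)).biUnion G, ?_, fun p hαp hpβ => ?_⟩
  · calc (((Finset.range (⌊Real.log (β / α)⌋₊ + 1)).biUnion G).card : ℝ)
        ≤ ∑ k ∈ Finset.range (⌊Real.log (β / α)⌋₊ + 1), ((G k).card : ℝ) := by
          exact_mod_cast Finset.card_biUnion_le
      _ ≤ ∑ _k ∈ Finset.range (⌊Real.log (β / α)⌋₊ + 1), ((2 * d + 5) * (ε / 6)⁻¹ : ℝ) ^ d :=
          Finset.sum_le_sum fun k _ => hcard k
      _ = ((2 * d + 5) * 6) ^ d * ε⁻¹ ^ d * (1 + ⌊Real.log (β / α)⌋₊) := by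
          rw [Finset.sum_const, Finset.card_range, nsmul_eq_mul, ← mul_pow, inv_div]
          push_cast
          ring
      _ ≤ ((2 * d + 5) * 6) ^ d * ε⁻¹ ^ d * (1 + Real.log (β / α)) := by
          gcongr
          exact Nat.floor_le hlog
  · have hp : 0 < ‖p - u‖ := hα.trans_le hαp
    set t := Real.log (‖p - u‖ / α) with ht
    have ht0 : 0 ≤ t := Real.log_nonneg ((one_le_div hα).mpr hαp)
    have hexp : ‖p - u‖ = Real.exp t * α := by
      rw [ht, Real.exp_log (by positivity)]
      field_simp
    have hfloor : Real.exp ⌊t⌋₊ * α ≤ ‖p - u‖ := by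
      rw [hexp]
      gcongr
      exact Nat.floor_le ht0
    obtain ⟨p', hp', hdist⟩ := hcover ⌊t⌋₊ p (by
      rw [hexp]
      gcongr
      exact (Nat.lt_floor_add_one t).le)
    refine ⟨p', Finset.mem_biUnion.mpr ⟨⌊t⌋₊, Finset.mem_range.mpr ?_, hp'⟩, hdist.trans ?_⟩
    · refine Nat.lt_succ_of_le (Nat.floor_le_floor ?_)
      exact Real.log_le_log (by positivity) (by gcongr)
    · calc ε / 6 * (Real.exp (⌊t⌋₊ + 1) * α)
          = ε / 6 * Real.exp 1 * (Real.exp ⌊t⌋₊ * α) := by rw [Real.exp_add]; ring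
        _ ≤ ε / 6 * 3 * ‖p - u‖ := by
          gcongr
          exact (Real.exp_one_lt_d9.trans (by norm_num)).le
        _ = ε / 2 * ‖p - u‖ := by ring

end Jaywalk
end
end
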